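/- Let h > 0 be a real number. Then Q(h) = 0 if and only if ∑_{s ∈ S} c₀^{s·h}·c₁^h = 1, where the sum over s ∈ S is taken in [0,∞]. -/

import Mathlib

open Filter

/-- The weight `c_ω` of a word `ω` over the alphabet `{0,1}` (here `false` is the
letter 0 and `true` is the letter 1): the product of `c0` over letters 0 and `c1`
over letters 1. -/
noncomputable def wt (c0 c1 : ℝ) (w : List Bool) : ℝ :=
  (w.map fun b => if b then c1 else c0).prod

/-- All words of length `n` over the alphabet `{0,1}`. -/
def allWords : ℕ → Finset (List Bool)
  | 0 => {[]}
  | n + 1 => (allWords n).biUnion fun w => {false :: w, true :: w}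

/-- Membership in the language of the S-gap shift: every maximal block of 0s lying
strictly between two 1s has length in `S`. -/
def InLang (S : Set ℕ) (w : List Bool) : Prop :=
  ∀ u v : List Bool, ∀ m : ℕ,
    w = u ++ [true] ++ List.replicate m false ++ [true] ++ v → m ∈ S

/-- Membership in the core set `G`: words of the form `0^{s₁}1 0^{s₂}1 ⋯ 0^{s_k}1`
with `k ≥ 1` and every `s_i ∈ S`. -/
def InCore (S : Set ℕ) (w : List Bool) : Prop :=
  ∃ bs : List ℕ, bs ≠ [] ∧ (∀ s ∈ bs, s ∈ S) ∧
    w = (bs.map fun s => List.replicate s false ++ [true]).flatten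

/-- `L_n`: the words of length `n` in the language of the S-gap shift. -/
noncomputable def langWords (S : Set ℕ) (n : ℕ) : Finset (List Bool) :=
  @Finset.filter _ (InLang S) (Classical.decPred _) (allWords n)

/-- `G_n`: the core words of length `n`. -/
noncomputable def coreWords (S : Set ℕ) (n : ℕ) : Finset (List Bool) :=
  @Finset.filter _ (InCore S) (Classical.decPred _) (allWords n)

/-- Extended-real logarithm with `log 0 = -∞`. -/
noncomputable def elog (x : ℝ) : EReal := if x = 0 then ⊥ else ((Real.log x : ℝ) : EReal)

/-- `Q(t) = limsup_{n → ∞} (1/n) log (∑_{ω ∈ G_n} c_ω^t)`, taken in the extended reals. -/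
noncomputable def Qfun (S : Set ℕ) (c0 c1 : ℝ) (t : ℝ) : EReal :=
  limsup (fun n : ℕ =>
    ((1 / (n : ℝ) : ℝ) : EReal) * elog (∑ ω ∈ coreWords S n, wt c0 c1 ω ^ t)) atTop

open scoped Topology

section Renewal

variable {p u : ℕ → ℝ}

/-- A renewal sequence whose step weights have total mass at most `1` is bounded by `1`. -/
lemma renewal_le_one (hp : ∀ s, 0 ≤ p s) (hu0 : u 0 = 1)
    (hrec : ∀ n, u (n + 1) = ∑ s ∈ Finset.range (n + 1), p s * u (n - s))
    (hsum : Summable p) (hle : ∑' s, p s ≤ 1) (n : ℕ) : u n ≤ 1 := by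
  induction n using Nat.strong_induction_on with
  | _ n ih =>
    cases n with
    | zero => exact hu0.le
    | succ n =>
      rw [hrec]
      calc ∑ s ∈ Finset.range (n + 1), p s * u (n - s)
          ≤ ∑ s ∈ Finset.range (n + 1), p s :=
            Finset.sum_le_sum fun s _ => mul_le_of_le_one_right (hp s) (ih _ (by omega))
        _ ≤ ∑' s, p s := hsum.sum_le_tsum _ fun s _ => hp s
        _ ≤ 1 := hle

/-- A renewal sequence whose step weights have total mass at least `1` is not summable. -/
lemma renewal_not_summable (hu : ∀ n, 0 ≤ u n) (hu0 : u 0 = 1)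
    (hrec : ∀ n, u (n + 1) = ∑ s ∈ Finset.range (n + 1), p s * u (n - s))
    (hsum : Summable p) (hle : 1 ≤ ∑' s, p s) : ¬ Summable u := by
  intro hus
  have h1 := tsum_mul_tsum_eq_tsum_sum_range_of_summable_norm hsum.norm hus.norm
  have h2 := hus.tsum_eq_zero_add
  simp only [hrec] at h2
  rw [← h1, hu0] at h2
  have h3 : 0 ≤ ∑' n, u n := tsum_nonneg hu
  nlinarith

/-- The rescaling `n ↦ u n * x ^ n` of a renewal sequence is a renewal sequence. -/
lemma renewal_rescale
    (hrec : ∀ n, u (n + 1) = ∑ s ∈ Finset.range (n + 1), p s * u (n - s)) (x : ℝ) (n : ℕ) :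
    u (n + 1) * x ^ (n + 1) =
      ∑ s ∈ Finset.range (n + 1), (p s * x ^ (s + 1)) * (u (n - s) * x ^ (n - s)) := by
  rw [hrec, Finset.sum_mul]
  refine Finset.sum_congr rfl fun s hs => ?_
  obtain ⟨k, rfl⟩ := Nat.exists_eq_add_of_le (Nat.lt_succ_iff.mp (Finset.mem_range.mp hs))
  rw [Nat.add_sub_cancel_left]
  ring

end Renewal

section GrowthRate

variable {u : ℕ → ℝ} {x : ℝ}

/-- The exponential growth rate of a sequence bounded by `x⁻¹ ^ n` is at most `-log x`. -/
lemma limsup_elog_le (hu : ∀ n, 0 ≤ u n) (hx : 0 < x) (hle : ∀ n, u n * x ^ n ≤ 1) :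
    limsup (fun n : ℕ => ((1 / (n : ℝ) : ℝ) : EReal) * elog (u n)) atTop
      ≤ ((-Real.log x : ℝ) : EReal) := by
  refine limsup_le_of_le (by isBoundedDefault) ?_
  filter_upwards [eventually_gt_atTop 0] with n hn
  have hn' : (0 : ℝ) < n := Nat.cast_pos.mpr hn
  unfold elog
  split_ifs with h0
  · rw [EReal.coe_mul_bot_of_pos (by positivity)]
    exact bot_le
  · have hpos : 0 < u n := lt_of_le_of_ne (hu n) (Ne.symm h0)
    have h1 := Real.log_nonpos (by positivity) (hle n)
    rw [Real.log_mul h0 (by positivity), Real.log_pow] at h1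
    rw [← EReal.coe_mul, EReal.coe_le_coe_iff, one_div, inv_mul_le_iff₀ hn']
    linarith

/-- If `∑ u n * x ^ n` diverges, the exponential growth rate of `u` is at least `-log x`. -/
lemma le_limsup_elog (hu : ∀ n, 0 ≤ u n) (hx : 0 < x) (hns : ¬ Summable fun n => u n * x ^ n) :
    ((-Real.log x : ℝ) : EReal) ≤
      limsup (fun n : ℕ => ((1 / (n : ℝ) : ℝ) : EReal) * elog (u n)) atTop := by
  by_contra! hlt
  obtain ⟨y, hy1, hy2⟩ := EReal.lt_iff_exists_real_btwn.mp hlt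
  rw [EReal.coe_lt_coe_iff] at hy2
  have hratio : Real.exp y * x < 1 := by
    rw [← Real.exp_log hx, ← Real.exp_add, Real.exp_lt_one_iff]
    linarith
  apply hns
  refine summable_of_isBigO_nat
    (summable_geometric_of_lt_one (r := Real.exp y * x) (by positivity) hratio) ?_
  refine Asymptotics.IsBigO.of_bound 1 ?_
  filter_upwards [eventually_gt_atTop 0, eventually_lt_of_limsup_lt hy1] with n hn hlt
  have hn' : (0 : ℝ) < n := Nat.cast_pos.mpr hn
  have hle : u n ≤ Real.exp y ^ n := by
    unfold elog at hlt
    split_ifs at hlt with h0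
    · rw [h0]
      positivity
    · have hpos : 0 < u n := lt_of_le_of_ne (hu n) (Ne.symm h0)
      rw [← EReal.coe_mul, EReal.coe_lt_coe_iff, one_div, inv_mul_lt_iff₀ hn'] at hlt
      rw [← Real.exp_nat_mul, ← Real.log_le_iff_le_exp hpos]
      exact hlt.le
  have := hu n
  rw [Real.norm_of_nonneg (by positivity), Real.norm_of_nonneg (by positivity), one_mul, mul_pow]
  gcongr

end GrowthRate

section Words

lemma mem_allWords {n : ℕ} {w : List Bool} : w ∈ allWords n ↔ w.length = n := by
  induction n generalizing w with
  | zero => simp [allWords]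
  | succ n ih =>
    cases w with
    | nil => simp [allWords]
    | cons b w => cases b <;> simp [allWords, ih]

/-- Concatenations of finitely many (possibly zero) blocks `0^s 1` with `s ∈ S`. -/
def InBlocks (S : Set ℕ) (w : List Bool) : Prop :=
  ∃ bs : List ℕ, (∀ s ∈ bs, s ∈ S) ∧
    w = (bs.map fun s => List.replicate s false ++ [true]).flatten

lemma inBlocks_nil (S : Set ℕ) : InBlocks S [] := ⟨[], by simp, by simp⟩

lemma inBlocks_block_append {S : Set ℕ} {s : ℕ} (hs : s ∈ S) {w : List Bool}
    (hw : InBlocks S w) : InBlocks S (List.replicate s false ++ true :: w) := by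
  obtain ⟨bs, h1, rfl⟩ := hw
  exact ⟨s :: bs, by simpa [hs] using h1, by simp⟩

lemma InBlocks.exists_block {S : Set ℕ} {w : List Bool} (hw : InBlocks S w) (hne : w ≠ []) :
    ∃ s ∈ S, ∃ v, InBlocks S v ∧ w = List.replicate s false ++ true :: v := by
  obtain ⟨bs, h1, rfl⟩ := hw
  cases bs with
  | nil => simp at hne
  | cons s bs =>
    exact ⟨s, h1 s (by simp), _, ⟨bs, fun t ht => h1 t (by simp [ht]), rfl⟩, by simp⟩

lemma inCore_iff_inBlocks {S : Set ℕ} {w : List Bool} (hne : w ≠ []) :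
    InCore S w ↔ InBlocks S w := by
  constructor
  · rintro ⟨bs, -, h1, h2⟩
    exact ⟨bs, h1, h2⟩
  · rintro ⟨bs, h1, h2⟩
    refine ⟨bs, ?_, h1, h2⟩
    rintro rfl
    exact hne (by simpa using h2)

lemma block_append_inj {s t : ℕ} {v w : List Bool}
    (h : List.replicate s false ++ true :: v = List.replicate t false ++ true :: w) :
    s = t ∧ v = w := by
  induction s generalizing t with
  | zero => cases t <;> simp_all [List.replicate_succ]
  | succ s ih =>
    cases t with
    | zero => simp [List.replicate_succ] at h
    | succ t =>
      have := ih (t := t) (by simpa [List.replicate_succ] using h)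
      simpa using this

/-- The words of length `n` that are concatenations of blocks. -/
noncomputable def blockWords (S : Set ℕ) (n : ℕ) : Finset (List Bool) :=
  @Finset.filter _ (InBlocks S) (Classical.decPred _) (allWords n)

lemma mem_blockWords {S : Set ℕ} {n : ℕ} {w : List Bool} :
    w ∈ blockWords S n ↔ w.length = n ∧ InBlocks S w := by
  simp [blockWords, mem_allWords]

lemma coreWords_eq_blockWords (S : Set ℕ) {n : ℕ} (hn : n ≠ 0) :
    coreWords S n = blockWords S n := by
  ext w
  simp only [coreWords, Finset.mem_filter, mem_allWords, mem_blockWords]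
  refine and_congr_right fun hw => inCore_iff_inBlocks ?_
  rintro rfl
  exact hn (by simpa using hw.symm)

lemma wt_pos {c0 c1 : ℝ} (hc0 : 0 < c0) (hc1 : 0 < c1) (w : List Bool) : 0 < wt c0 c1 w := by
  refine List.prod_pos ?_
  simp only [List.mem_map]
  rintro _ ⟨b, -, rfl⟩
  split_ifs <;> assumption

lemma wt_block_append (c0 c1 : ℝ) (s : ℕ) (w : List Bool) :
    wt c0 c1 (List.replicate s false ++ true :: w) = c0 ^ s * c1 * wt c0 c1 w := by
  simp [wt, mul_assoc]

open Classical in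
/-- The weight of the block `0^s 1`, raised to the power `h`, for `s ∈ S`. -/
noncomputable def blockWeight (S : Set ℕ) (c0 c1 h : ℝ) (s : ℕ) : ℝ :=
  if s ∈ S then c0 ^ ((s : ℝ) * h) * c1 ^ h else 0

/-- The total weight of concatenations of blocks having length `n`. -/
noncomputable def blockSum (S : Set ℕ) (c0 c1 h : ℝ) (n : ℕ) : ℝ :=
  ∑ w ∈ blockWords S n, wt c0 c1 w ^ h

variable (S : Set ℕ) {c0 c1 : ℝ} (h : ℝ)

lemma blockWeight_nonneg (hc0 : 0 < c0) (hc1 : 0 < c1) (s : ℕ) :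
    0 ≤ blockWeight S c0 c1 h s := by
  unfold blockWeight
  split_ifs <;> positivity

lemma blockSum_nonneg (hc0 : 0 < c0) (hc1 : 0 < c1) (n : ℕ) : 0 ≤ blockSum S c0 c1 h n :=
  Finset.sum_nonneg fun w _ => (Real.rpow_pos_of_pos (wt_pos hc0 hc1 w) h).le

lemma blockSum_zero (c0 c1 : ℝ) : blockSum S c0 c1 h 0 = 1 := by
  have : blockWords S 0 = {[]} := by
    ext w
    rw [mem_blockWords, List.length_eq_zero_iff, Finset.mem_singleton]
    exact ⟨fun hw => hw.1, fun hw => ⟨hw, hw ▸ inBlocks_nil S⟩⟩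
  simp [blockSum, this, wt]

lemma blockSum_succ (hc0 : 0 < c0) (hc1 : 0 < c1) (n : ℕ) :
    blockSum S c0 c1 h (n + 1) =
      ∑ s ∈ Finset.range (n + 1), blockWeight S c0 c1 h s * blockSum S c0 c1 h (n - s) := by
  classical
  simp only [blockWeight, ite_mul, zero_mul]
  rw [← Finset.sum_filter]
  simp only [blockSum, Finset.mul_sum]
  rw [Finset.sum_sigma']
  symm
  refine Finset.sum_bij (fun a _ => List.replicate a.1 false ++ true :: a.2) ?_ ?_ ?_ ?_
  · rintro ⟨s, w⟩ ha
    simp only [Finset.mem_sigma, Finset.mem_filter, Finset.mem_range, mem_blockWords] at ha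
    refine mem_blockWords.mpr ⟨?_, inBlocks_block_append ha.1.2 ha.2.2⟩
    simp only [List.length_append, List.length_replicate, List.length_cons]
    omega
  · rintro ⟨s, v⟩ - ⟨t, w⟩ - heq
    obtain ⟨h1, h2⟩ := block_append_inj heq
    dsimp only at h1 h2
    rw [h1, h2]
  · intro w hw
    obtain ⟨hlen, hb⟩ := mem_blockWords.mp hw
    obtain ⟨s, hs, v, hv, rfl⟩ := hb.exists_block (by rintro rfl; simp at hlen)
    simp only [List.length_append, List.length_replicate, List.length_cons] at hlen
    refine ⟨⟨s, v⟩, ?_, rfl⟩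
    simp only [Finset.mem_sigma, Finset.mem_filter, Finset.mem_range, mem_blockWords]
    exact ⟨⟨by omega, hs⟩, by omega, hv⟩
  · rintro ⟨s, w⟩ -
    have := wt_pos hc0 hc1 w
    dsimp only
    rw [wt_block_append, Real.mul_rpow (by positivity) (by positivity),
      Real.mul_rpow (by positivity) (by positivity), Real.rpow_mul hc0.le, Real.rpow_natCast]

lemma Qfun_eq_limsup_blockSum (c0 c1 : ℝ) :
    Qfun S c0 c1 h =
      limsup (fun n : ℕ => ((1 / (n : ℝ) : ℝ) : EReal) * elog (blockSum S c0 c1 h n)) atTop := by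
  refine limsup_congr ?_
  filter_upwards [eventually_ne_atTop 0] with n hn
  rw [coreWords_eq_blockWords S hn, blockSum]

end Words

section Series

variable (S : Set ℕ) {c0 c1 h : ℝ}

lemma blockWeight_le (hc0 : 0 < c0) (hc1 : 0 < c1) (hc1' : c1 ≤ 1) (hh : 0 < h) (s : ℕ) :
    blockWeight S c0 c1 h s ≤ (c0 ^ h) ^ s := by
  have h1 : c0 ^ ((s : ℝ) * h) = (c0 ^ h) ^ s := by
    rw [mul_comm, Real.rpow_mul hc0.le, Real.rpow_natCast]
  unfold blockWeight
  split_ifs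
  · rw [h1]
    exact mul_le_of_le_one_right (by positivity) (Real.rpow_le_one hc1.le hc1' hh.le)
  · positivity

lemma blockWeight_mul_pow_le (hc0 : 0 < c0) (hc1 : 0 < c1) (hc1' : c1 ≤ 1) (hh : 0 < h)
    {x y : ℝ} (hx : x ∈ Set.Icc 0 y) (s : ℕ) :
    blockWeight S c0 c1 h s * x ^ (s + 1) ≤ (c0 ^ h * y) ^ s * y := by
  have hx0 := hx.1
  calc blockWeight S c0 c1 h s * x ^ (s + 1) ≤ (c0 ^ h) ^ s * y ^ (s + 1) :=
        mul_le_mul (blockWeight_le S hc0 hc1 hc1' hh s) (pow_le_pow_left₀ hx.1 hx.2 _)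
          (by positivity) (by positivity)
    _ = (c0 ^ h * y) ^ s * y := by ring

lemma summable_geometric_mul {r y : ℝ} (hr : 0 < r) (hy : 0 ≤ y) (hry : r * y < 1) :
    Summable fun s : ℕ => (r * y) ^ s * y :=
  (summable_geometric_of_lt_one (by positivity) hry).mul_right y

lemma summable_blockWeight_mul_pow (hc0 : 0 < c0) (hc1 : 0 < c1) (hc1' : c1 ≤ 1) (hh : 0 < h)
    {x : ℝ} (hx : 0 ≤ x) (hlt : c0 ^ h * x < 1) :
    Summable fun s => blockWeight S c0 c1 h s * x ^ (s + 1) :=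
  Summable.of_nonneg_of_le
    (fun s => mul_nonneg (blockWeight_nonneg S h hc0 hc1 s) (by positivity))
    (blockWeight_mul_pow_le S hc0 hc1 hc1' hh ⟨hx, le_rfl⟩)
    (summable_geometric_mul (Real.rpow_pos_of_pos hc0 h) hx hlt)

lemma continuousAt_tsum_blockWeight (hc0 : 0 < c0) (hc0' : c0 < 1) (hc1 : 0 < c1)
    (hc1' : c1 ≤ 1) (hh : 0 < h) :
    ContinuousAt (fun x : ℝ => ∑' s, blockWeight S c0 c1 h s * x ^ (s + 1)) 1 := by
  have hr : 0 < c0 ^ h := Real.rpow_pos_of_pos hc0 h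
  obtain ⟨y, hy1, hy2⟩ := exists_between ((one_lt_inv₀ hr).mpr (Real.rpow_lt_one hc0.le hc0' hh))
  have hry : c0 ^ h * y < 1 := by rwa [mul_comm, ← lt_inv_mul_iff₀' hr, mul_one]
  have hcont : ContinuousOn (fun x : ℝ => ∑' s, blockWeight S c0 c1 h s * x ^ (s + 1))
      (Set.Icc 0 y) := by
    refine continuousOn_tsum (fun s => by fun_prop)
      (summable_geometric_mul hr (by linarith) hry) fun s x hx => ?_
    have := blockWeight_nonneg S h hc0 hc1 s
    have := hx.1
    rw [Real.norm_of_nonneg (by positivity)]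
    exact blockWeight_mul_pow_le S hc0 hc1 hc1' hh hx s
  exact hcont.continuousAt (Icc_mem_nhds one_pos hy1)

lemma tsum_ofReal_eq_blockWeight (hc0 : 0 < c0) (hc1 : 0 < c1)
    (hsum : Summable (blockWeight S c0 c1 h)) :
    ∑' s : S, ENNReal.ofReal (c0 ^ (((s : ℕ) : ℝ) * h) * c1 ^ h) =
      ENNReal.ofReal (∑' s, blockWeight S c0 c1 h s) := by
  classical
  rw [ENNReal.ofReal_tsum_of_nonneg (blockWeight_nonneg S h hc0 hc1) hsum,
    tsum_subtype S fun s : ℕ => ENNReal.ofReal (c0 ^ ((s : ℝ) * h) * c1 ^ h)]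
  refine tsum_congr fun s => ?_
  by_cases hs : s ∈ S <;> simp [blockWeight, hs]

lemma Qfun_le_neg_log (hc0 : 0 < c0) (hc1 : 0 < c1) {x : ℝ} (hx : 0 < x)
    (hsum : Summable fun s => blockWeight S c0 c1 h s * x ^ (s + 1))
    (hle : ∑' s, blockWeight S c0 c1 h s * x ^ (s + 1) ≤ 1) :
    Qfun S c0 c1 h ≤ ((-Real.log x : ℝ) : EReal) := by
  rw [Qfun_eq_limsup_blockSum]
  refine limsup_elog_le (blockSum_nonneg S h hc0 hc1) hx ?_
  exact renewal_le_one (u := fun n => blockSum S c0 c1 h n * x ^ n)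
    (fun s => mul_nonneg (blockWeight_nonneg S h hc0 hc1 s) (by positivity))
    (by simp [blockSum_zero]) (renewal_rescale (blockSum_succ S h hc0 hc1) x) hsum hle

lemma neg_log_le_Qfun (hc0 : 0 < c0) (hc1 : 0 < c1) {x : ℝ} (hx : 0 < x)
    (hsum : Summable fun s => blockWeight S c0 c1 h s * x ^ (s + 1))
    (hle : 1 ≤ ∑' s, blockWeight S c0 c1 h s * x ^ (s + 1)) :
    ((-Real.log x : ℝ) : EReal) ≤ Qfun S c0 c1 h := by
  rw [Qfun_eq_limsup_blockSum]
  refine le_limsup_elog (blockSum_nonneg S h hc0 hc1) hx ?_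
  exact renewal_not_summable
    (fun n => mul_nonneg (blockSum_nonneg S h hc0 hc1 n) (by positivity))
    (by simp [blockSum_zero]) (renewal_rescale (blockSum_succ S h hc0 hc1) x) hsum hle

end Series

/-- For h > 0, Q(h) = 0 iff ∑_{s ∈ S} c₀^{s·h}·c₁^h = 1 (sum in [0,∞]). -/
theorem stmt8
    (S : Set ℕ) (hS : S.Infinite)
    (c0 c1 cb0 cb1 : ℝ)
    (hc0 : 0 < c0) (hc0b : c0 ≤ cb0) (hcb0 : cb0 < 1)
    (hc1 : 0 < c1) (hc1b : c1 ≤ cb1) (hcb1 : cb1 < 1)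
    (h : ℝ) (hh : 0 < h) :
    Qfun S c0 c1 h = 0 ↔
      ∑' s : S, ENNReal.ofReal (c0 ^ (((s : ℕ) : ℝ) * h) * c1 ^ h) = 1 := by
  have hc0' : c0 < 1 := hc0b.trans_lt hcb0
  have hc1' : c1 ≤ 1 := (hc1b.trans_lt hcb1).le
  have hr1 : c0 ^ h * 1 < 1 := by simpa using Real.rpow_lt_one hc0.le hc0' hh
  have hsummable {x : ℝ} (hx : 0 ≤ x) (hlt : c0 ^ h * x < 1) :=
    summable_blockWeight_mul_pow S hc0 hc1 hc1' hh hx hlt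
  have hsum1 := hsummable zero_le_one hr1
  have hcont := continuousAt_tsum_blockWeight S hc0 hc0' hc1 hc1' hh
  have hradius : ∀ᶠ x : ℝ in 𝓝 1, c0 ^ h * x < 1 :=
    (continuous_const.mul continuous_id).continuousAt.eventually_lt_const hr1
  have hpos : ∀ᶠ x : ℝ in 𝓝 1, 0 < x := eventually_gt_nhds one_pos
  rw [tsum_ofReal_eq_blockWeight S hc0 hc1 (by simpa using hsum1), ENNReal.ofReal_eq_one]
  have hF1 : ∑' s, blockWeight S c0 c1 h s = ∑' s, blockWeight S c0 c1 h s * 1 ^ (s + 1) := by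
    simp
  rw [hF1]
  constructor
  · intro hQ
    rcases lt_trichotomy (∑' s, blockWeight S c0 c1 h s * 1 ^ (s + 1)) 1 with hlt | heq | hgt
    · obtain ⟨x, ⟨⟨hx1, hx2⟩, hx3⟩, hx4⟩ :=
        (((((hcont.eventually_lt_const hlt).and hradius).and hpos).filter_mono
          nhdsWithin_le_nhds).and (self_mem_nhdsWithin (s := Set.Ioi (1 : ℝ)))).exists
      have hle := Qfun_le_neg_log S hc0 hc1 hx3 (hsummable hx3.le hx2) hx1.le
      rw [hQ, EReal.coe_nonneg] at hle
      linarith [Real.log_pos hx4]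
    · exact heq
    · obtain ⟨x, ⟨⟨hx1, hx2⟩, hx3⟩, hx4⟩ :=
        (((((hcont.eventually_const_lt hgt).and hradius).and hpos).filter_mono
          nhdsWithin_le_nhds).and (self_mem_nhdsWithin (s := Set.Iio (1 : ℝ)))).exists
      have hle := neg_log_le_Qfun S hc0 hc1 hx3 (hsummable hx3.le hx2) hx1.le
      rw [hQ, EReal.coe_nonpos] at hle
      linarith [Real.log_neg hx3 hx4]
  · intro heq
    have h1 := Qfun_le_neg_log S hc0 hc1 one_pos hsum1 heq.le
    have h2 := neg_log_le_Qfun S hc0 hc1 one_pos hsum1 heq.ge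
    simp only [Real.log_one, neg_zero, EReal.coe_zero] at h1 h2
    exact le_antisymm h1 h2
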